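/- Cylinder preservation of PN subdivision: let d = 3 and suppose the initial data lie on the unit circular cylinder {(x,y,z) : x² + y² = 1} with generatrix parallel to the z-axis, i.e. p_j = (x_j, y_j, z_j) with x_j² + y_j² = 1 and n_j = (x_j, y_j, 0) for all j ∈ ℤ. Assume ν_i = Σ_j a_{i−2j} n_j ≠ 0 and ⟨n_j + n'_i, n'_i⟩ ≠ 0 whenever a_{i−2j} ≠ 0. Then for every i ∈ ℤ, the new normal n'_i has vanishing third coordinate, and the new point satisfies p'_i = (x'_i, y'_i, Σ_j a_{i−2j} z_j) where (x'_i, y'_i, 0) = n'_i and (x'_i)² + (y'_i)² = 1; in particular all points produced by one PN subdivision step lie on the same unit cylinder. -/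

import Mathlib

open scoped RealInnerProductSpace BigOperators Matrix

noncomputable section

variable {d : ℕ}

/-- The linearly subdivided point `q_i = Σ_j a_{i-2j} p_j` (also used for the
unnormalized subdivided normal `ν_i = Σ_j a_{i-2j} n_j`). -/
def pnQ (a : ℤ → ℝ) (p : ℤ → EuclideanSpace ℝ (Fin d)) (i : ℤ) :
    EuclideanSpace ℝ (Fin d) :=
  ∑ᶠ j : ℤ, a (i - 2 * j) • p j

/-- The new normal `n'_i = ν_i / ‖ν_i‖`. -/
def pnN (a : ℤ → ℝ) (n : ℤ → EuclideanSpace ℝ (Fin d)) (i : ℤ) :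
    EuclideanSpace ℝ (Fin d) :=
  ‖pnQ a n i‖⁻¹ • pnQ a n i

/-- The height `h_{ij} = ⟨n_j + n'_i, p_j − q_i⟩ / ⟨n_j + n'_i, n'_i⟩`. -/
def pnH (a : ℤ → ℝ) (p n : ℤ → EuclideanSpace ℝ (Fin d)) (i j : ℤ) : ℝ :=
  ⟪n j + pnN a n i, p j - pnQ a p i⟫ / ⟪n j + pnN a n i, pnN a n i⟫

/-- The new point `p'_i = q_i + (Σ_j a_{i-2j} h_{ij}) n'_i`. -/
def pnP (a : ℤ → ℝ) (p n : ℤ → EuclideanSpace ℝ (Fin d)) (i : ℤ) :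
    EuclideanSpace ℝ (Fin d) :=
  pnQ a p i + (∑ᶠ j : ℤ, a (i - 2 * j) * pnH a p n i j) • pnN a n i

/-- One PN subdivision step is well defined: all `ν_i ≠ 0`, and
`⟨n_j + n'_i, n'_i⟩ ≠ 0` whenever `a_{i-2j} ≠ 0`. -/
def pnWellDefined (a : ℤ → ℝ) (p n : ℤ → EuclideanSpace ℝ (Fin d)) : Prop :=
  (∀ i : ℤ, pnQ a n i ≠ 0) ∧
    ∀ i j : ℤ, a (i - 2 * j) ≠ 0 → ⟪n j + pnN a n i, pnN a n i⟫ ≠ 0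

theorem finite_support_mask {a : ℤ → ℝ} (ha : (Function.support a).Finite) (i : ℤ) :
    (Function.support fun j : ℤ => a (i - 2 * j)).Finite :=
  ha.preimage (f := fun j : ℤ => i - 2 * j) fun x _ y _ h => by
    dsimp only at h
    omega

theorem pnQ_apply {a : ℤ → ℝ} (ha : (Function.support a).Finite)
    (p : ℤ → EuclideanSpace ℝ (Fin d)) (i : ℤ) (k : Fin d) :
    pnQ a p i k = ∑ᶠ j : ℤ, a (i - 2 * j) * p j k := by
  have hs : (Function.support fun j : ℤ => a (i - 2 * j) • p j).Finite :=
    (finite_support_mask ha i).subset fun j hj h => hj (by simp [show a (i - 2 * j) = 0 from h])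
  exact (EuclideanSpace.proj (𝕜 := ℝ) k).toLinearMap.toAddMonoidHom.map_finsum hs

theorem norm_pnN {a : ℤ → ℝ} {n : ℤ → EuclideanSpace ℝ (Fin d)} {i : ℤ}
    (hν : pnQ a n i ≠ 0) : ‖pnN a n i‖ = 1 :=
  norm_smul_inv_norm (𝕜 := ℝ) hν

theorem norm_smul_pnN {a : ℤ → ℝ} {n : ℤ → EuclideanSpace ℝ (Fin d)} {i : ℤ}
    (hν : pnQ a n i ≠ 0) : ‖pnQ a n i‖ • pnN a n i = pnQ a n i :=
  smul_inv_smul₀ (norm_ne_zero_iff.mpr hν) _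

/-- Cylinder preservation of PN subdivision.  In `ℝ³`, suppose the data
lie on the unit cylinder `{x² + y² = 1}` with generatrix parallel to the `z`-axis:
`p_j = (x_j, y_j, z_j)` with `x_j² + y_j² = 1` and `n_j = (x_j, y_j, 0)`.  If the step
is well defined then the new normal `n'_i` has vanishing third coordinate,
`(n'_i)_x² + (n'_i)_y² = 1`, and the new point is
`p'_i = ((n'_i)_x, (n'_i)_y, Σ_j a_{i-2j} z_j)`; in particular all new points lie on
the same unit cylinder. -/
theorem pn_step_cylinder_preserving
    (a : ℤ → ℝ) (ha : (Function.support a).Finite)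
    (haff : ∀ i : ℤ, ∑ᶠ j : ℤ, a (i - 2 * j) = 1)
    (p n : ℤ → EuclideanSpace ℝ (Fin 3))
    (hcyl : ∀ j : ℤ, (p j 0) ^ 2 + (p j 1) ^ 2 = 1)
    (hn0 : ∀ j : ℤ, n j 0 = p j 0)
    (hn1 : ∀ j : ℤ, n j 1 = p j 1)
    (hn2 : ∀ j : ℤ, n j 2 = 0)
    (hν : ∀ i : ℤ, pnQ a n i ≠ 0)
    (hden : ∀ i j : ℤ, a (i - 2 * j) ≠ 0 → ⟪n j + pnN a n i, pnN a n i⟫ ≠ 0) :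
    ∀ i : ℤ,
      pnN a n i 2 = 0 ∧
      (pnN a n i 0) ^ 2 + (pnN a n i 1) ^ 2 = 1 ∧
      pnP a p n i 0 = pnN a n i 0 ∧
      pnP a p n i 1 = pnN a n i 1 ∧
      pnP a p n i 2 = ∑ᶠ j : ℤ, a (i - 2 * j) * p j 2 ∧
      (pnP a p n i 0) ^ 2 + (pnP a p n i 1) ^ 2 = 1 := by
  intro i
  have hQ (k : Fin 3) : pnQ a n i k = ‖pnQ a n i‖ * pnN a n i k :=
    (congrArg (· k) (norm_smul_pnN (hν i))).symm
  have hQ0 : pnQ a p i 0 = ‖pnQ a n i‖ * pnN a n i 0 := by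
    rw [← hQ, pnQ_apply ha, pnQ_apply ha]
    simp only [hn0]
  have hQ1 : pnQ a p i 1 = ‖pnQ a n i‖ * pnN a n i 1 := by
    rw [← hQ, pnQ_apply ha, pnQ_apply ha]
    simp only [hn1]
  have hN2 : pnN a n i 2 = 0 := by
    have h : pnQ a n i 2 = 0 := by simp [pnQ_apply ha, hn2]
    simp [pnN, h]
  have hN : (pnN a n i 0) ^ 2 + (pnN a n i 1) ^ 2 = 1 := by
    have h := EuclideanSpace.real_norm_sq_eq (pnN a n i)
    rw [norm_pnN (hν i), Fin.sum_univ_three, hN2] at h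
    linarith
  have hH (j : ℤ) (hj : a (i - 2 * j) ≠ 0) : pnH a p n i j = 1 - ‖pnQ a n i‖ := by
    rw [pnH, div_eq_iff (hden i j hj)]
    simp only [PiLp.inner_apply, Fin.sum_univ_three, PiLp.add_apply, PiLp.sub_apply,
      RCLike.inner_apply, conj_trivial, hn0, hn1, hn2, hN2, hQ0, hQ1]
    linear_combination hcyl j - hN
  have hsum : ∑ᶠ j : ℤ, a (i - 2 * j) * pnH a p n i j = 1 - ‖pnQ a n i‖ := by
    have h (j : ℤ) : a (i - 2 * j) * pnH a p n i j = a (i - 2 * j) * (1 - ‖pnQ a n i‖) := by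
      by_cases hj : a (i - 2 * j) = 0
      · simp [hj]
      · rw [hH j hj]
    rw [finsum_congr h, ← finsum_mul, haff, one_mul]
  have hP (k : Fin 3) : pnP a p n i k = pnQ a p i k + (1 - ‖pnQ a n i‖) * pnN a n i k := by
    rw [pnP, hsum]
    rfl
  have hP0 : pnP a p n i 0 = pnN a n i 0 := by rw [hP, hQ0]; ring
  have hP1 : pnP a p n i 1 = pnN a n i 1 := by rw [hP, hQ1]; ring
  have hP2 : pnP a p n i 2 = ∑ᶠ j : ℤ, a (i - 2 * j) * p j 2 := by
    rw [hP, hN2, mul_zero, add_zero, pnQ_apply ha]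
  exact ⟨hN2, hN, hP0, hP1, hP2, by rw [hP0, hP1, hN]⟩
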